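/- arXiv:1307.5411 — 2 statements merged into one kernel-verified Lean document; each statement's English description precedes it below -/
import Mathlib

section
/- Let n be a positive integer and let G be a graph cospectral with the friendship graph F_n. Suppose x and y are two non-adjacent vertices of G, each of degree 2, that have at least one common neighbour, and suppose G has no induced subgraph isomorphic to the 6-vertex graph consisting of two 4-cycles sharing a common edge (the graph P_2 × P_3). Then G is isomorphic to F_n. -/
open Polynomial

/-- The adjacency matrix of a simple graph, with entries in `R`. -/
noncomputable def adjMat (R : Type*) [Zero R] [One R] {V : Type*} [Fintype V]
    (G : SimpleGraph V) : Matrix V V R :=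
  letI := Classical.decRel G.Adj
  G.adjMatrix R

/-- The friendship graph `F n`: `n` triangles glued at the common vertex `none`. -/
def friendshipGraph (n : ℕ) : SimpleGraph (Option (Fin n × Bool)) :=
  SimpleGraph.fromRel (fun u v =>
    u = none ∨ ∃ i : Fin n, u = some (i, true) ∧ v = some (i, false))

/-- Two finite graphs are cospectral if their real adjacency matrices have the same
characteristic polynomial. -/
def Cospectral {V W : Type*} [Fintype V] [Fintype W] [DecidableEq V] [DecidableEq W]
    (G : SimpleGraph V) (H : SimpleGraph W) : Prop :=
  (adjMat ℝ G).charpoly = (adjMat ℝ H).charpoly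

/-- The 6-vertex "domino" graph: two 4-cycles sharing a common edge
(the graph `P₂ × P₃` of the paper). Vertices `0,1,2` and `3,4,5` form the two paths,
with rungs `0–3`, `1–4`, `2–5`; the two squares `0,1,4,3` and `1,2,5,4` share the
edge `1–4`. -/
def dominoGraph : SimpleGraph (Fin 6) :=
  SimpleGraph.fromRel (fun u v =>
    (u = 0 ∧ v = 1) ∨ (u = 1 ∧ v = 2) ∨ (u = 3 ∧ v = 4) ∨ (u = 4 ∧ v = 5) ∨
    (u = 0 ∧ v = 3) ∨ (u = 1 ∧ v = 4) ∨ (u = 2 ∧ v = 5))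

open scoped Matrix

open Matrix in
/-- Real symmetric matrices with the same characteristic polynomial are orthogonally similar. -/
theorem exists_orthogonal_conj_of_charpoly_eq {V W : Type*} [Fintype V] [Fintype W]
    [DecidableEq V] [DecidableEq W] {A : Matrix V V ℝ} {B : Matrix W W ℝ}
    (hA : A.IsHermitian) (hB : B.IsHermitian) (h : A.charpoly = B.charpoly) :
    ∃ P : Matrix V W ℝ, P * Pᵀ = 1 ∧ Pᵀ * P = 1 ∧ A = P * B * Pᵀ := by
  have hcard : Fintype.card V = Fintype.card W := by
    rw [← A.charpoly_natDegree_eq_dim, ← B.charpoly_natDegree_eq_dim, h]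
  let e : W ≃ V := Fintype.equivOfCardEq hcard.symm
  have hB' : (B.reindex e e).IsHermitian := hB.submatrix _
  have heig : hA.eigenvalues = hB'.eigenvalues := by
    rw [hA.eigenvalues_eq_eigenvalues_iff, charpoly_reindex, h]
  have sA := hA.spectral_theorem
  have sB := hB'.spectral_theorem
  rw [Unitary.conjStarAlgAut_apply] at sA sB
  rw [← heig] at sB
  generalize hA.eigenvectorUnitary = U at sA
  generalize hB'.eigenvectorUnitary = T at sB
  generalize (diagonal (RCLike.ofReal ∘ hA.eigenvalues) : Matrix V V ℝ) = D at sA sB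
  have hU : (U : Matrix V V ℝ) * (U : Matrix V V ℝ)ᵀ = 1 := Unitary.mul_star_self_of_mem U.2
  have hU' : (U : Matrix V V ℝ)ᵀ * (U : Matrix V V ℝ) = 1 := Unitary.star_mul_self_of_mem U.2
  have hT : (T : Matrix V V ℝ) * (T : Matrix V V ℝ)ᵀ = 1 := Unitary.mul_star_self_of_mem T.2
  have hT' : (T : Matrix V V ℝ)ᵀ * (T : Matrix V V ℝ) = 1 := Unitary.star_mul_self_of_mem T.2
  have star_eq (X : Matrix V V ℝ) : star X = Xᵀ := rfl
  rw [star_eq] at sA sB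
  generalize (U : Matrix V V ℝ) = U at *
  generalize (T : Matrix V V ℝ) = T at *
  have hQ : (U * Tᵀ) * (U * Tᵀ)ᵀ = 1 := by
    rw [transpose_mul, transpose_transpose, Matrix.mul_assoc, ← Matrix.mul_assoc Tᵀ, hT',
      Matrix.one_mul, hU]
  have hQ' : (U * Tᵀ)ᵀ * (U * Tᵀ) = 1 := by
    rw [transpose_mul, transpose_transpose, Matrix.mul_assoc, ← Matrix.mul_assoc Uᵀ, hU',
      Matrix.one_mul, hT]
  have hconj : A = (U * Tᵀ) * B.reindex e e * (U * Tᵀ)ᵀ := by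
    rw [sB, sA, transpose_mul, transpose_transpose]
    simp only [Matrix.mul_assoc]
    rw [← Matrix.mul_assoc Tᵀ T, ← Matrix.mul_assoc Tᵀ T, hT', Matrix.one_mul, Matrix.one_mul]
  generalize U * Tᵀ = Q at *
  refine ⟨Q.submatrix id e, ?_, ?_, ?_⟩
  · rw [transpose_submatrix, submatrix_mul_equiv, hQ, submatrix_id_id]
  · rw [transpose_submatrix, ← submatrix_mul _ _ e id e Function.bijective_id, hQ',
      submatrix_one_equiv]
  · have hB'' : B = (B.reindex e e).submatrix e e := by ext; simp
    rw [transpose_submatrix, hB'', submatrix_mul_equiv, submatrix_mul_equiv]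
    simpa using hconj

theorem friendshipGraph_adj_some_some {n : ℕ} (i j : Fin n) (b c : Bool) :
    (friendshipGraph n).Adj (some (i, b)) (some (j, c)) ↔ i = j ∧ b ≠ c := by
  simp only [friendshipGraph, SimpleGraph.fromRel_adj]
  cases b <;> cases c <;> simp [eq_comm]

theorem friendshipGraph_adj_none_some {n : ℕ} (p : Fin n × Bool) :
    (friendshipGraph n).Adj none (some p) := by
  simp [friendshipGraph]

theorem adjMat_apply {V : Type*} [Fintype V] (G : SimpleGraph V) [DecidableRel G.Adj] (v w : V) :
    adjMat ℝ G v w = if G.Adj v w then 1 else 0 := by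
  simp [adjMat]

theorem adjMat_friendshipGraph (n : ℕ) :
    adjMat ℝ (friendshipGraph n) = Matrix.of fun u v => match u, v with
      | none, none => 0
      | none, some _ => 1
      | some _, none => 1
      | some (i, b), some (j, c) => if i = j then (if b = c then 0 else 1) else 0 := by
  classical
  ext (_ | ⟨i, b⟩) (_ | ⟨j, c⟩)
  · simp [adjMat_apply]
  · simp [adjMat_apply, friendshipGraph_adj_none_some]
  · simp [adjMat_apply, (friendshipGraph_adj_none_some _).symm]
  · by_cases i = j <;> by_cases b = c <;> simp_all [adjMat_apply, friendshipGraph_adj_some_some]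

/-- The square of the adjacency matrix of the friendship graph, minus the identity, is a
combination of two rank one matrices. -/
theorem adjMat_friendshipGraph_mul_self (n : ℕ) :
    adjMat ℝ (friendshipGraph n) * adjMat ℝ (friendshipGraph n) - 1 =
      Matrix.vecMulVec 1 1 +
        (2 * n - 2 : ℝ) • Matrix.vecMulVec (Pi.single none 1) (Pi.single none 1) := by
  rw [adjMat_friendshipGraph]
  ext (_ | ⟨i, b⟩) (_ | ⟨j, c⟩) <;>
  simp [Matrix.mul_apply, Fintype.sum_option, Fintype.sum_prod_type, -Finset.sum_boole,
    Matrix.vecMulVec_apply, Matrix.one_apply]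
  · ring
  · cases c <;> simp
  · cases b <;> simp
  · cases b <;> cases c <;> by_cases h : i = j <;> simp [h, -Finset.sum_boole]

theorem adjMat_friendshipGraph_mulVec_one (n : ℕ) :
    adjMat ℝ (friendshipGraph n) *ᵥ 1 =
      (2 : ℝ) • 1 + (2 * n - 2 : ℝ) • Pi.single none 1 := by
  rw [adjMat_friendshipGraph]
  ext (_ | ⟨i, b⟩) <;>
  simp [Matrix.mulVec, dotProduct, Fintype.sum_option, Fintype.sum_prod_type, -Finset.sum_boole]
  · ring
  · cases b <;> norm_num

theorem adjMat_friendshipGraph_mulVec_single (n : ℕ) :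
    adjMat ℝ (friendshipGraph n) *ᵥ Pi.single none 1 = 1 - Pi.single none 1 := by
  rw [adjMat_friendshipGraph]
  ext (_ | ⟨i, b⟩) <;> simp

theorem isHermitian_adjMat {V : Type*} [Fintype V] (G : SimpleGraph V) :
    (adjMat ℝ G).IsHermitian := by
  classical
  ext v w
  simp [adjMat_apply, G.adj_comm]

theorem Cospectral.card_eq {V W : Type*} [Fintype V] [Fintype W] [DecidableEq V] [DecidableEq W]
    {G : SimpleGraph V} {H : SimpleGraph W} (h : Cospectral G H) :
    Fintype.card V = Fintype.card W := by
  rw [← (adjMat ℝ G).charpoly_natDegree_eq_dim, ← (adjMat ℝ H).charpoly_natDegree_eq_dim, h]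

/-- For a graph cospectral with `friendshipGraph n`, the adjacency matrix `A` preserves a plane
spanned by two vectors `w`, `u` on the complement of which `A ^ 2` is the identity. -/
theorem Cospectral.exists_gram {V : Type*} [Fintype V] [DecidableEq V] {n : ℕ}
    {G : SimpleGraph V} (hG : Cospectral G (friendshipGraph n)) :
    ∃ w u : V → ℝ,
      adjMat ℝ G * adjMat ℝ G - 1 =
        Matrix.vecMulVec w w + (2 * n - 2 : ℝ) • Matrix.vecMulVec u u ∧
      adjMat ℝ G *ᵥ w = (2 : ℝ) • w + (2 * n - 2 : ℝ) • u ∧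
      adjMat ℝ G *ᵥ u = w - u ∧ w ⬝ᵥ w = 2 * n + 1 ∧ u ⬝ᵥ u = 1 ∧
      w ⬝ᵥ u = 1 := by
  obtain ⟨P, hP', hP, hA⟩ :=
    exists_orthogonal_conj_of_charpoly_eq (isHermitian_adjMat G) (isHermitian_adjMat _) hG
  have hv (v : Option (Fin n × Bool) → ℝ) :
      adjMat ℝ G *ᵥ (P *ᵥ v) = P *ᵥ (adjMat ℝ (friendshipGraph n) *ᵥ v) := by
    simp only [hA, Matrix.mulVec_mulVec, Matrix.mul_assoc, hP, Matrix.mul_one]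
  have hdot (v v' : Option (Fin n × Bool) → ℝ) : (P *ᵥ v) ⬝ᵥ (P *ᵥ v') = v ⬝ᵥ v' := by
    rw [Matrix.dotProduct_mulVec, Matrix.vecMul_mulVec, hP]
    simp
  refine ⟨P *ᵥ 1, P *ᵥ Pi.single none 1, ?_, ?_, ?_, ?_, ?_, ?_⟩
  · have hsq : adjMat ℝ G * adjMat ℝ G - 1 =
        P * (adjMat ℝ (friendshipGraph n) * adjMat ℝ (friendshipGraph n) - 1) * Pᵀ := by
      rw [Matrix.mul_sub, Matrix.sub_mul, Matrix.mul_one, hP', hA]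
      simp only [Matrix.mul_assoc]
      rw [← Matrix.mul_assoc Pᵀ P, hP, Matrix.one_mul]
    rw [hsq, adjMat_friendshipGraph_mul_self, Matrix.mul_add, Matrix.add_mul, Matrix.mul_smul,
      Matrix.smul_mul, Matrix.mul_vecMulVec, Matrix.vecMulVec_mul, Matrix.mul_vecMulVec,
      Matrix.vecMulVec_mul, Matrix.vecMul_transpose, Matrix.vecMul_transpose]
  · rw [hv, adjMat_friendshipGraph_mulVec_one, Matrix.mulVec_add, Matrix.mulVec_smul,
      Matrix.mulVec_smul]
  · rw [hv, adjMat_friendshipGraph_mulVec_single, Matrix.mulVec_sub]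
  · rw [hdot]
    simp
    ring
  · rw [hdot]
    simp
  · rw [hdot]
    simp

theorem adjMat_mul_self_apply {V : Type*} [Fintype V] [DecidableEq V] (G : SimpleGraph V)
    [DecidableRel G.Adj] (v w : V) :
    (adjMat ℝ G * adjMat ℝ G) v w = (G.neighborFinset v ∩ G.neighborFinset w).card := by
  simp only [Matrix.mul_apply, adjMat_apply, ← ite_and, mul_ite, mul_one, mul_zero]
  rw [Finset.sum_boole]
  congr 2
  ext t
  simp [G.adj_comm, and_comm]

theorem adjMat_mul_self_apply_self {V : Type*} [Fintype V] [DecidableEq V] (G : SimpleGraph V)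
    [DecidableRel G.Adj] (v : V) :
    (adjMat ℝ G * adjMat ℝ G) v v = G.degree v := by
  simp [adjMat_mul_self_apply]

theorem adjMat_mul_self_apply_of_neighborFinset_eq_pair {V : Type*} [Fintype V] [DecidableEq V]
    {G : SimpleGraph V} [DecidableRel G.Adj] {x z p : V} (hzp : z ≠ p)
    (hN : G.neighborFinset x = {z, p}) (v : V) :
    (adjMat ℝ G * adjMat ℝ G) x v = (if G.Adj z v then 1 else 0) + if G.Adj p v then 1 else 0 := by
  have h (t : V) : adjMat ℝ G x t * adjMat ℝ G t v =
      if t ∈ G.neighborFinset x then (if G.Adj t v then 1 else 0) else 0 := by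
    simp only [adjMat_apply, SimpleGraph.mem_neighborFinset]
    split_ifs <;> simp
  simp only [Matrix.mul_apply, h, Finset.sum_ite_mem, Finset.univ_inter, hN]
  exact Finset.sum_pair hzp

/-- The relation `M * M = M * A + (2 * n - 1) * M` for `M = A ^ 2 - 1`, which says that the
eigenvalues of `A` other than `1` and `-1` are roots of `X ^ 2 - X - 2 * n`. -/
theorem Cospectral.exists_gram_and_relation {V : Type*} [Fintype V] [DecidableEq V] {n : ℕ}
    {G : SimpleGraph V} (hG : Cospectral G (friendshipGraph n)) :
    ∃ (M : Matrix V V ℝ) (w u : V → ℝ),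
      M = adjMat ℝ G * adjMat ℝ G - 1 ∧
      (∀ v v', M v v' = w v * w v' + (2 * n - 2) * (u v * u v')) ∧
      (∀ v v', ∑ t, M v t * M t v' = ∑ t, M v t * adjMat ℝ G t v' + (2 * n - 1) * M v v') ∧
      ∑ v, M v v = 4 * n - 1 := by
  obtain ⟨w, u, hM, hw, hu, hww, huu, hwu⟩ := hG.exists_gram
  have hsymm : (adjMat ℝ G)ᵀ = adjMat ℝ G := isHermitian_adjMat G
  refine ⟨_, w, u, rfl, ?_, ?_, ?_⟩
  · intro v v'
    rw [hM]
    simp [Matrix.vecMulVec_apply]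
  · intro v v'
    have key : (adjMat ℝ G * adjMat ℝ G - 1) * (adjMat ℝ G * adjMat ℝ G - 1) =
        (adjMat ℝ G * adjMat ℝ G - 1) * adjMat ℝ G +
          (2 * n - 1 : ℝ) • (adjMat ℝ G * adjMat ℝ G - 1) := by
      rw [hM]
      have h (a : V → ℝ) : a ᵥ* adjMat ℝ G = adjMat ℝ G *ᵥ a := by
        rw [← Matrix.mulVec_transpose, hsymm]
      simp only [Matrix.add_mul, Matrix.mul_add, Matrix.smul_mul, Matrix.mul_smul,
        Matrix.vecMulVec_mul, Matrix.vecMul_vecMulVec, h, hw, hu, hww, huu, hwu,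
        dotProduct_comm u w]
      ext i j
      simp [Matrix.vecMulVec_apply]
      ring
    simpa [Matrix.mul_apply] using congr_fun₂ key v v'
  · simp only [dotProduct] at hww huu
    simp only [hM, Matrix.add_apply, Matrix.smul_apply, Matrix.vecMulVec_apply,
      Finset.sum_add_distrib, smul_eq_mul, ← Finset.mul_sum, hww, huu]
    ring

/-- Three vectors in a plane have vanishing Gram determinant. -/
theorem gram_det_eq_zero {V : Type*} {M : Matrix V V ℝ} {w u : V → ℝ} {k : ℝ}
    (hM : ∀ v v', M v v' = w v * w v' + k * (u v * u v')) (a b c : V) :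
    M a a * (M b b * M c c - M b c ^ 2) - M a b * (M a b * M c c - M b c * M a c) +
      M a c * (M a b * M b c - M b b * M a c) = 0 := by
  simp only [hM]
  ring

theorem gram_sq_le {V : Type*} {M : Matrix V V ℝ} {w u : V → ℝ} {k : ℝ} (hk : 0 ≤ k)
    (hM : ∀ v v', M v v' = w v * w v' + k * (u v * u v')) (a b : V) :
    M a b ^ 2 ≤ M a a * M b b := by
  have h : M a a * M b b - M a b ^ 2 = k * (w a * u b - w b * u a) ^ 2 := by
    simp only [hM]
    ring
  nlinarith [mul_nonneg hk (sq_nonneg (w a * u b - w b * u a))]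

theorem gram_row_eq {V : Type*} {M : Matrix V V ℝ} {w u : V → ℝ} {k : ℝ} (hk : 0 ≤ k)
    (hM : ∀ v v', M v v' = w v * w v' + k * (u v * u v')) {a b : V}
    (haa : M a a = 1) (hbb : M b b = 1) (hab : M a b = 1) (v : V) : M a v = M b v := by
  have h : (w a - w b) ^ 2 + k * (u a - u b) ^ 2 = 0 := by
    linear_combination (hM a a).symm.trans haa + (hM b b).symm.trans hbb -
      2 * (hM a b).symm.trans hab
  have h1 : 0 ≤ k * (u a - u b) ^ 2 := mul_nonneg hk (sq_nonneg _)
  have hw : w a - w b = 0 := by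
    rw [← sq_eq_zero_iff]
    linarith [sq_nonneg (w a - w b)]
  have hu : k * (u a - u b) = 0 := by
    rw [hw] at h
    rcases mul_eq_zero.mp (by linarith : k * (u a - u b) ^ 2 = 0) with h | h
    · simp [h]
    · simp [pow_eq_zero_iff two_ne_zero |>.mp h]
  rw [hM, hM]
  linear_combination w v * hw + u v * hu

/-- The domino graph is an induced subgraph as soon as its vertices can be located. -/
theorem nonempty_dominoGraph_embedding {V : Type*} {G : SimpleGraph V} {x z y p t q : V}
    (hxz : G.Adj x z) (hzy : G.Adj z y) (hpt : G.Adj p t) (htq : G.Adj t q) (hxp : G.Adj x p)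
    (hzt : G.Adj z t) (hyq : G.Adj y q) (hxy : ¬ G.Adj x y) (hxt : ¬ G.Adj x t)
    (hxq : ¬ G.Adj x q) (hzp : ¬ G.Adj z p) (hzq : ¬ G.Adj z q) (hyp : ¬ G.Adj y p)
    (hyt : ¬ G.Adj y t) (hpq : ¬ G.Adj p q) :
    Nonempty (dominoGraph ↪g G) := by
  have hadj (i j : Fin 6) :
      G.Adj (![x, z, y, p, t, q] i) (![x, z, y, p, t, q] j) ↔ dominoGraph.Adj i j := by
    fin_cases i <;> fin_cases j <;>
      simp_all [dominoGraph, SimpleGraph.fromRel_adj, G.adj_comm]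
  refine ⟨⟨⟨![x, z, y, p, t, q], fun i j h ↦ ?_⟩, hadj _ _⟩⟩
  have hnbr (k : Fin 6) : dominoGraph.Adj i k ↔ dominoGraph.Adj j k := by
    rw [← hadj, ← hadj, h]
  simp only [dominoGraph, SimpleGraph.fromRel_adj, Fin.forall_fin_succ] at hnbr
  fin_cases i <;> fin_cases j <;> simp at hnbr ⊢

/-- A graph on `2 * n + 1` vertices with a universal vertex whose other vertices all have degree
two is a friendship graph. -/
theorem nonempty_iso_friendshipGraph {V : Type*} [Fintype V] [DecidableEq V] {n : ℕ}
    {G : SimpleGraph V} [DecidableRel G.Adj] (hcard : Fintype.card V = 2 * n + 1) {z : V}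
    (hz : ∀ v, v ≠ z → G.Adj z v) (hdeg : ∀ v, v ≠ z → G.degree v = 2) :
    Nonempty (G ≃g friendshipGraph n) := by
  have hpartner (v : V) (hv : v ≠ z) : ∃ v', ∀ t, G.Adj v t ↔ t = z ∨ t = v' := by
    obtain ⟨a, b, -, hab⟩ := Finset.card_eq_two.mp (hdeg v hv)
    have h (t : V) : G.Adj v t ↔ t = a ∨ t = b := by
      rw [← G.mem_neighborFinset, hab]
      simp
    rcases (h z).mp (hz v hv).symm with rfl | rfl
    · exact ⟨b, h⟩
    · exact ⟨a, fun t ↦ (h t).trans or_comm⟩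
  choose! σ hσ using hpartner
  have hdeg' (v : V) (hv : v ≠ z) : σ v ≠ z := by
    intro h
    have : G.neighborFinset v ⊆ {z} := fun t ht ↦ by
      have := (hσ v hv t).mp ((G.mem_neighborFinset v t).mp ht)
      simpa [h] using this
    have := Finset.card_le_card this
    rw [G.card_neighborFinset_eq_degree, hdeg v hv] at this
    simp at this
  have hadj (v : V) (hv : v ≠ z) : G.Adj v (σ v) := (hσ v hv _).mpr (Or.inr rfl)
  have hσσ (v : V) (hv : v ≠ z) : σ (σ v) = v :=
    (((hσ _ (hdeg' v hv) v).mp (hadj v hv).symm).resolve_left hv).symm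
  have hadj' (v t : V) (hv : v ≠ z) (ht : t ≠ z) : G.Adj v t ↔ t = σ v := by
    simp [hσ v hv, ht]
  let e := Fintype.equivFin V
  let T := {v : V // v ≠ z ∧ e v < e (σ v)}
  let φ : Option (T × Bool) → V := fun a ↦ match a with
    | none => z
    | some (t, true) => t
    | some (t, false) => σ t
  have hφinj : Function.Injective φ := by
    rintro (_ | ⟨⟨s, hs, hs'⟩, _ | _⟩) (_ | ⟨⟨t, ht, ht'⟩, _ | _⟩) h <;>
      simp only [φ] at h
    · rfl
    · exact absurd h.symm (hdeg' t ht)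
    · exact absurd h.symm ht
    · exact absurd h (hdeg' s hs)
    · have : s = t := by rw [← hσσ s hs, h, hσσ t ht]
      simp [this]
    · subst h
      rw [hσσ s hs] at ht'
      exact absurd ht' hs'.asymm
    · exact absurd h hs
    · subst h
      rw [hσσ t ht] at hs'
      exact absurd hs' ht'.asymm
    · simp [h]
  have hφsurj : Function.Surjective φ := by
    intro v
    by_cases hv : v = z
    · exact ⟨none, hv.symm⟩
    rcases lt_trichotomy (e v) (e (σ v)) with h | h | h
    · exact ⟨some (⟨v, hv, h⟩, true), rfl⟩
    · exact absurd (e.injective h) (hadj v hv).ne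
    · exact ⟨some (⟨σ v, hdeg' v hv, by rwa [hσσ v hv]⟩, false), hσσ v hv⟩
  have hT : Fintype.card T = n := by
    have := Fintype.card_of_bijective ⟨hφinj, hφsurj⟩
    rw [Fintype.card_option, Fintype.card_prod, Fintype.card_bool] at this
    omega
  let f : Option (Fin n × Bool) ≃ V :=
    (((Fintype.equivFinOfCardEq hT).symm.prodCongr (Equiv.refl Bool)).optionCongr).trans
      (Equiv.ofBijective φ ⟨hφinj, hφsurj⟩)
  have hf : ∀ a b, G.Adj (f a) (f b) ↔ (friendshipGraph n).Adj a b := by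
    have hnone : f none = z := rfl
    have hne (p) : f (some p) ≠ z := fun h ↦ by
      simpa using f.injective (h.trans hnone.symm)
    have hflip (i : Fin n) (b : Bool) : σ (f (some (i, b))) = f (some (i, !b)) := by
      cases b
      · exact hσσ _ ((Fintype.equivFinOfCardEq hT).symm i).2.1
      · rfl
    rintro (_ | ⟨i, b⟩) (_ | ⟨j, c⟩)
    · simp
    · rw [hnone]
      simp [hz _ (hne _), friendshipGraph_adj_none_some]
    · rw [hnone]
      simp [(hz _ (hne _)).symm, (friendshipGraph_adj_none_some _).symm]
    · rw [hadj' _ _ (hne _) (hne _), hflip, f.injective.eq_iff, friendshipGraph_adj_some_some]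
      cases b <;> cases c <;> simp [eq_comm]
  exact ⟨(⟨f, hf _ _⟩ : friendshipGraph n ≃g G).symm⟩

/-- let `G` be cospectral with the friendship graph `F n`. If `x, y` are two
non-adjacent vertices of degree 2 having at least one common neighbour, and `G` has no
induced subgraph isomorphic to the domino graph (two 4-cycles sharing an edge), then
`G ≅ F n`. -/
theorem cospectral_nonadjacent_degree_two_common_neighbour_iso
    {V : Type*} [Fintype V] [DecidableEq V]
    (n : ℕ) (hn : 0 < n) (G : SimpleGraph V) [DecidableRel G.Adj]
    (hG : Cospectral G (friendshipGraph n))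
    (x y : V) (hne : x ≠ y) (hnadj : ¬ G.Adj x y)
    (hdx : G.degree x = 2) (hdy : G.degree y = 2)
    (hcommon : ∃ z : V, G.Adj x z ∧ G.Adj y z)
    (hdomino : IsEmpty (dominoGraph ↪g G)) :
    Nonempty (G ≃g friendshipGraph n) := by
  obtain ⟨M, w, u, hMA, hM, hR, htr⟩ := hG.exists_gram_and_relation
  have hk : (0 : ℝ) ≤ 2 * n - 2 := by
    have : (1 : ℝ) ≤ n := by exact_mod_cast hn
    linarith
  obtain ⟨z, hxz, hyz⟩ := hcommon
  have hpair (v : V) (hv : G.degree v = 2) (hvz : G.Adj v z) :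
      ∃ p, z ≠ p ∧ G.neighborFinset v = {z, p} := by
    obtain ⟨a, b, hab, hN⟩ := Finset.card_eq_two.mp hv
    have hz : z ∈ ({a, b} : Finset V) := hN ▸ (G.mem_neighborFinset v z).mpr hvz
    rcases Finset.mem_insert.mp hz with rfl | hz
    · exact ⟨b, hab, hN⟩
    · obtain rfl := Finset.mem_singleton.mp hz
      exact ⟨a, hab.symm, hN.trans (Finset.pair_comm _ _)⟩
  obtain ⟨p, hzp, hNx⟩ := hpair x hdx hxz
  obtain ⟨q, hzq, hNy⟩ := hpair y hdy hyz
  have hx (v : V) : G.Adj x v ↔ v = z ∨ v = p := by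
    rw [← G.mem_neighborFinset, hNx]
    simp
  have hy (v : V) : G.Adj y v ↔ v = z ∨ v = q := by
    rw [← G.mem_neighborFinset, hNy]
    simp
  have hxp : G.Adj x p := (hx p).mpr (Or.inr rfl)
  have hyq : G.Adj y q := (hy q).mpr (Or.inr rfl)
  have hMdiag (v : V) : M v v = G.degree v - 1 := by
    simp [hMA, adjMat_mul_self_apply_self]
  have hMcard (v v' : V) (h : v ≠ v') :
      M v v' = (G.neighborFinset v ∩ G.neighborFinset v').card := by
    simp [hMA, adjMat_mul_self_apply, Matrix.one_apply_ne h]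
  have hMsymm (v v' : V) : M v v' = M v' v := by
    rw [hM, hM]
    ring
  have hMx (v : V) : M x v = ((if G.Adj z v then 1 else 0) + if G.Adj p v then 1 else 0) -
      if x = v then 1 else 0 := by
    simp [hMA, adjMat_mul_self_apply_of_neighborFinset_eq_pair hzp hNx, Matrix.one_apply]
  have hMy (v : V) : M y v = ((if G.Adj z v then 1 else 0) + if G.Adj q v then 1 else 0) -
      if y = v then 1 else 0 := by
    simp [hMA, adjMat_mul_self_apply_of_neighborFinset_eq_pair hzq hNy, Matrix.one_apply]
  have hMxx : M x x = 1 := by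
    rw [hMdiag, hdx]
    norm_num
  have hMyy : M y y = 1 := by
    rw [hMdiag, hdy]
    norm_num
  have hpy : ¬ G.Adj p y := by
    intro h
    have h1 := gram_sq_le hk hM x y
    rw [hMxx, hMyy, hMx, if_pos hyz.symm, if_pos h, if_neg hne] at h1
    norm_num at h1
  have hpq : p ≠ q := fun h ↦ hpy (h ▸ hyq.symm)
  have hMxy : M x y = 1 := by
    rw [hMx, if_pos hyz.symm, if_neg hpy, if_neg hne]
    norm_num
  have hqx : ¬ G.Adj q x := fun h ↦ by
    rcases (hx q).mp h.symm with h | h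
    · exact hzq h.symm
    · exact hpq h.symm
  have hrow := gram_row_eq hk hM hMxx hMyy hMxy
  have htwin (v : V) (hvx : x ≠ v) (hvy : y ≠ v) : G.Adj p v ↔ G.Adj q v := by
    have h := hrow v
    rw [hMx, hMy, if_neg hvx, if_neg hvy] at h
    split_ifs at h <;> simp_all
  have hpq' : ¬ G.Adj p q := fun h ↦
    G.irrefl ((htwin q (fun h' ↦ hnadj (h' ▸ hyq.symm)) hyq.ne).mp h)
  have hMxz : M x z = if G.Adj p z then 1 else 0 := by
    simp [hMx, hxz.ne]
  have hMxp : M x p = if G.Adj p z then 1 else 0 := by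
    simp [hMx, hxp.ne, G.adj_comm]
  have hdet := gram_det_eq_zero hM x z p
  have hzq_iff : G.Adj p z ↔ G.Adj q z := htwin z hxz.ne hyz.ne
  by_cases hpz : G.Adj p z
  · have hqz := hzq_iff.mp hpz
    rw [if_pos hpz] at hMxz hMxp
    have hcz : (G.neighborFinset z ∩ G.neighborFinset p).card + 3 ≤ G.degree z := by
      have hdisj : Disjoint (G.neighborFinset z ∩ G.neighborFinset p) {p, q, y} := by
        rw [Finset.disjoint_right]
        simp [hpq', hpy]
      have h3 : ({p, q, y} : Finset V).card = 3 := Finset.card_eq_three.mpr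
        ⟨p, q, y, hpq, fun h ↦ hnadj (h ▸ hxp), hyq.ne.symm, rfl⟩
      rw [← h3, ← Finset.card_union_of_disjoint hdisj, ← G.card_neighborFinset_eq_degree]
      refine Finset.card_le_card (Finset.union_subset Finset.inter_subset_left ?_)
      simp [Finset.insert_subset_iff, hpz.symm, hqz.symm, hyz.symm]
    have hcp : (G.neighborFinset z ∩ G.neighborFinset p).card + 1 ≤ G.degree p := by
      have hz : z ∉ G.neighborFinset z ∩ G.neighborFinset p := by simp
      rw [← Finset.card_insert_of_notMem hz, ← G.card_neighborFinset_eq_degree]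
      exact Finset.card_le_card
        (Finset.insert_subset (by simpa using hpz) Finset.inter_subset_right)
    have hc1 : 1 ≤ (G.neighborFinset z ∩ G.neighborFinset p).card :=
      Finset.card_pos.mpr ⟨x, by simp [hxz.symm, hxp.symm]⟩
    rw [hMxx, hMxz, hMxp, hMdiag, hMdiag, hMcard z p hzp] at hdet
    generalize (G.neighborFinset z ∩ G.neighborFinset p).card = c at hdet hcz hcp hc1
    have hdp : G.degree p = 2 := by
      by_contra hdp
      have h3 : 3 ≤ G.degree p := by omega
      have hcz' : (c : ℝ) + 3 ≤ G.degree z := by exact_mod_cast hcz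
      have hcp' : (c : ℝ) + 1 ≤ G.degree p := by exact_mod_cast hcp
      have hc1' : (1 : ℝ) ≤ c := by exact_mod_cast hc1
      have h3' : (3 : ℝ) ≤ G.degree p := by exact_mod_cast h3
      nlinarith [mul_nonneg (sub_nonneg.mpr hc1') (sub_nonneg.mpr hcp'),
        mul_nonneg (sub_nonneg.mpr hcz') (by linarith : (0 : ℝ) ≤ G.degree p - 2)]
    have hNp : ∀ v, G.Adj p v ↔ v = z ∨ v = x := by
      have hsub : ({z, x} : Finset V) ⊆ G.neighborFinset p := by
        simp [Finset.insert_subset_iff, hpz, hxp.symm]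
      have heq := Finset.eq_of_subset_of_card_le hsub (by
        rw [G.card_neighborFinset_eq_degree, hdp, Finset.card_pair hxz.ne.symm])
      intro v
      rw [← G.mem_neighborFinset, ← heq]
      simp
    have hMx' (v : V) : M x v = if v ∈ insert z (G.neighborFinset z) then 1 else 0 := by
      rw [hMx]
      by_cases hvz : v = z
      · subst hvz
        simp [hpz, hxz.ne]
      · by_cases hvx : v = x
        · subst hvx
          simp [hxz.symm, hxp.symm]
        · simp [hNp, hvz, hvx, Ne.symm hvx]
    have hdz : G.degree z = 2 * n := by
      have h := hR x x
      have h1 : ∑ t, M x t * M t x = G.degree z + 1 := by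
        have (t : V) : M x t * M t x = if t ∈ insert z (G.neighborFinset z) then 1 else 0 := by
          rw [hMsymm t x, hMx']
          split_ifs <;> simp
        simp only [this]
        rw [Finset.sum_boole, Finset.filter_univ_mem, Finset.card_insert_of_notMem (by simp)]
        simp
      have h2 : ∑ t, M x t * adjMat ℝ G t x = 2 := by
        have (t : V) : M x t * adjMat ℝ G t x = if t ∈ G.neighborFinset x then M x t else 0 := by
          simp [adjMat_apply, G.adj_comm]
        simp only [this, Finset.sum_ite_mem, Finset.univ_inter, hNx]
        rw [Finset.sum_pair hzp, hMxz, hMxp]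
        norm_num
      rw [h1, h2, hMxx] at h
      have : (G.degree z : ℝ) = (2 * n : ℕ) := by
        push_cast
        linarith
      exact_mod_cast this
    have hcard : Fintype.card V = 2 * n + 1 := by
      rw [hG.card_eq]
      simp [mul_comm]
    have hz (v : V) (hv : v ≠ z) : G.Adj z v := by
      have huniv : insert z (G.neighborFinset z) = Finset.univ := by
        apply Finset.eq_univ_of_card
        rw [Finset.card_insert_of_notMem (by simp), G.card_neighborFinset_eq_degree, hdz, hcard]
      have h := Finset.mem_univ v
      rw [← huniv] at h
      simpa [hv] using h
    have hge (v : V) : 2 ≤ G.degree v := by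
      have h := gram_sq_le hk hM x v
      have hv : M x v = 1 := by
        rw [hMx']
        by_cases hv : v = z <;> simp [hv, hz]
      rw [hMxx, hv, hMdiag] at h
      have : (2 : ℝ) ≤ G.degree v := by linarith
      exact_mod_cast this
    have hdegsum : ∑ v, (G.degree v : ℝ) = 6 * n := by
      simp only [hMdiag, Finset.sum_sub_distrib, Finset.sum_const, Finset.card_univ, hcard] at htr
      push_cast [nsmul_eq_mul] at htr
      linarith
    have hsum : ∑ v ∈ Finset.univ.erase z, (G.degree v - 2 : ℝ) = 0 := by
      rw [Finset.sum_erase_eq_sub (Finset.mem_univ z), Finset.sum_sub_distrib, hdegsum, hdz]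
      simp [hcard]
      ring
    refine nonempty_iso_friendshipGraph hcard hz fun v hv ↦ ?_
    have h := (Finset.sum_eq_zero_iff_of_nonneg fun t _ ↦ ?_).mp hsum v (by simp [hv])
    · have : (G.degree v : ℝ) = (2 : ℕ) := by
        push_cast
        linarith
      exact_mod_cast this
    · have : (2 : ℝ) ≤ G.degree t := by exact_mod_cast hge t
      linarith
  · exfalso
    have hqz : ¬ G.Adj q z := fun h ↦ hpz (hzq_iff.mpr h)
    rw [if_neg hpz] at hMxz hMxp
    have hMzp : M z p = 1 := by
      rw [hMcard z p hzp, Nat.cast_eq_one, Finset.card_eq_one]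
      refine ⟨x, Finset.eq_singleton_iff_unique_mem.mpr
        ⟨by simp [hxz.symm, hxp.symm], fun t ht ↦ ?_⟩⟩
      simp only [Finset.mem_inter, SimpleGraph.mem_neighborFinset] at ht
      by_contra htx
      have hty : y ≠ t := fun h ↦ hpy (h ▸ ht.2)
      have hxt : ¬ G.Adj x t := fun h ↦ by
        rcases (hx t).mp h with rfl | rfl
        · exact hpz ht.2
        · exact G.irrefl ht.2
      have hqt := (htwin t (Ne.symm htx) hty).mp ht.2
      have hyt : ¬ G.Adj y t := fun h ↦ by
        rcases (hy t).mp h with rfl | rfl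
        · exact hqz hqt
        · exact G.irrefl hqt
      exact hdomino.elim' (nonempty_dominoGraph_embedding hxz hyz.symm ht.2 hqt.symm hxp ht.1 hyq
        hnadj hxt (fun h ↦ hqx h.symm) (fun h ↦ hpz h.symm) (fun h ↦ hqz h.symm)
        (fun h ↦ hpy h.symm) hyt hpq').some
    rw [hMxx, hMxz, hMxp, hMzp, hMdiag, hMdiag] at hdet
    have hdz2 : 2 ≤ G.degree z := by
      rw [← G.card_neighborFinset_eq_degree, ← Finset.card_pair hne]
      exact Finset.card_le_card (by simp [Finset.insert_subset_iff, hxz.symm, hyz.symm])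
    have hdz : G.degree z = 2 := by
      have h : ((G.degree z : ℤ) - 1) * ((G.degree p : ℤ) - 1) = 1 := by
        have : ((G.degree z : ℝ) - 1) * ((G.degree p : ℝ) - 1) = 1 := by linarith
        exact_mod_cast this
      rcases Int.mul_eq_one_iff_eq_one_or_neg_one.mp h with h | h <;> omega
    have hNz : G.neighborFinset z = {x, y} := by
      refine (Finset.eq_of_subset_of_card_le ?_ ?_).symm
      · simp [Finset.insert_subset_iff, hxz.symm, hyz.symm]
      · rw [G.card_neighborFinset_eq_degree, hdz, Finset.card_pair hne]
    have h := hR x z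
    have h1 : ∑ t, M x t * M t z = 0 := by
      refine Finset.sum_eq_zero fun t _ ↦ ?_
      by_cases htz : t = z
      · simp [htz, hMxz]
      by_cases htp : t = p
      · simp [htp, hMxp]
      have hMzt : M t z = (if G.Adj x t then 1 else 0) + if G.Adj y t then 1 else 0 := by
        rw [hMsymm, hMA, Matrix.sub_apply, Matrix.one_apply_ne (Ne.symm htz), sub_zero,
          adjMat_mul_self_apply_of_neighborFinset_eq_pair hne hNz]
      by_cases htq : t = q
      · have : M x q = 0 := by
          rw [hMx, if_neg (fun h ↦ hqz h.symm), if_neg hpq',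
            if_neg (by rintro rfl; exact hnadj hyq.symm)]
          norm_num
        simp [htq, this]
      · simp [hMzt, hx, hy, htz, htp, htq]
    have h2 : ∑ t, M x t * adjMat ℝ G t z = 2 := by
      have (t : V) : M x t * adjMat ℝ G t z = if t ∈ G.neighborFinset z then M x t else 0 := by
        simp [adjMat_apply, G.adj_comm]
      simp only [this, Finset.sum_ite_mem, Finset.univ_inter, hNz]
      rw [Finset.sum_pair hne, hMxx, hMxy]
      norm_num
    rw [h1, h2, hMxz] at h
    norm_num at h
end

section
/- For every integer n ≥ 3, the complement of the friendship graph F_n is determined by its adjacency spectrum: every graph cospectral with the complement of F_n is isomorphic to the complement of F_n (which is the disjoint union of the cocktail party graph CP(n) and an isolated vertex, with spectrum {(−2)^{n−1}, (0)^{n+1}, (2n−2)^1}). -/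
open Polynomial

theorem multipartite_arith (a b c m : ℤ) (ha : 0 < a) (hb : 0 < b) (ha' : a < m) (hb' : b < m)
    (hc : c = a + b - m) (hc0 : 0 ≤ c) (h : (c + 2) ^ 2 = a * b) : m = 5 ∨ a = m - 2 := by
  subst hc
  obtain ⟨u, rfl⟩ : ∃ u, a = m - 2 - u := ⟨m - 2 - a, by ring⟩
  obtain ⟨v, rfl⟩ : ∃ v, b = m - 2 - v := ⟨m - 2 - b, by ring⟩
  have key : u ^ 2 + v ^ 2 + u * v = (m - 2) * (u + v) := by linear_combination h
  by_cases hu : u = 0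
  · right; omega
  by_cases hv : v = 0
  · exfalso
    subst hv
    have : u * (u - (m - 2)) = 0 := by linear_combination key
    rcases mul_eq_zero.1 this with h1 | h1 <;> omega
  have aux : ∀ w : ℤ, -1 ≤ w → w ≠ 0 → w ^ 2 + 1 - w = (m - 2) * (w - 1) → m = 5 := by
    intro w h1 h2 h3
    have hw : (w - 1) * (m - 2 - w) = 1 := by linear_combination -h3
    rcases Int.eq_one_or_neg_one_of_mul_eq_one hw with h5 | h5
    · rw [h5] at hw; omega
    · omega
  left
  rcases (by omega : u = -1 ∨ 1 ≤ u) with rfl | hu1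
  · exact aux v (by omega) hv (by linear_combination key)
  rcases (by omega : v = -1 ∨ 1 ≤ v) with rfl | hv1
  · exact aux u (by omega) hu (by linear_combination key)
  · exfalso
    nlinarith [mul_pos (show 0 < u by omega) (show 0 < v by omega),
      mul_nonneg (show 0 ≤ u + v by omega) (show 0 ≤ m - 4 - u - v by omega)]

theorem exists_equiv_prod_bool_of_card_fiber {α β : Type*} [Fintype α] [DecidableEq β] (n : ℕ)
    (f : α → β) (hα : Fintype.card α = 2 * n)
    (hf : ∀ x, (Finset.univ.filter fun y => f y = f x).card = 2) :
    ∃ e : α ≃ Fin n × Bool, ∀ x y, (e x).1 = (e y).1 ↔ f x = f y := by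
  classical
  have hfib : ∀ q : Set.range f, Nonempty ({x // Set.rangeFactorization f x = q} ≃ Bool) := by
    rintro ⟨_, x, rfl⟩
    refine ⟨Fintype.equivOfCardEq ?_⟩
    rw [Fintype.card_bool, ← hf x, Fintype.card_subtype]
    congr 1
    ext y
    simp [Set.rangeFactorization, Subtype.ext_iff]
  let e₁ : α ≃ Set.range f × Bool :=
    (Equiv.sigmaFiberEquiv (Set.rangeFactorization f)).symm.trans
      ((Equiv.sigmaCongrRight fun q => (hfib q).some).trans (Equiv.sigmaEquivProd _ _))
  have he₁ : ∀ x, (e₁ x).1 = Set.rangeFactorization f x := fun x => rfl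
  have hcard : Fintype.card (Set.range f) = Fintype.card (Fin n) := by
    have := Fintype.card_congr e₁
    rw [Fintype.card_prod, Fintype.card_bool, hα] at this
    simp only [Fintype.card_fin]
    omega
  let e₂ := Fintype.equivOfCardEq hcard
  refine ⟨e₁.trans (e₂.prodCongr (Equiv.refl _)), fun x y => ?_⟩
  simp [he₁, Set.rangeFactorization]

namespace SimpleGraph

theorem friendshipGraph_compl_not_adj_none (n : ℕ) (v) : ¬ (friendshipGraph n)ᶜ.Adj none v := by
  simp only [compl_adj, friendshipGraph, fromRel_adj]
  tauto

theorem friendshipGraph_compl_adj_some (n : ℕ) (p q : Fin n × Bool) :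
    (friendshipGraph n)ᶜ.Adj (some p) (some q) ↔ p.1 ≠ q.1 := by
  obtain ⟨i, b⟩ := p
  obtain ⟨j, c⟩ := q
  cases b <;> cases c <;> simp [friendshipGraph, eq_comm]

variable {W : Type*} [Fintype W] [DecidableEq W] (G : SimpleGraph W) [DecidableRel G.Adj]

theorem nonempty_iso_compl_friendshipGraph {n : ℕ} (w₀ : W) (h₀ : ∀ y, ¬ G.Adj w₀ y)
    (hcard : Fintype.card W = 2 * n + 1)
    (hadj : ∀ x y, x ≠ w₀ → y ≠ w₀ → (G.Adj x y ↔ G.neighborFinset x ≠ G.neighborFinset y))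
    (hfib : ∀ x, x ≠ w₀ →
      (Finset.univ.filter fun y => y ≠ w₀ ∧ G.neighborFinset y = G.neighborFinset x).card = 2) :
    Nonempty (G ≃g (friendshipGraph n)ᶜ) := by
  obtain ⟨e, he⟩ := exists_equiv_prod_bool_of_card_fiber (α := {x // x ≠ w₀}) n
    (fun x => G.neighborFinset x) (by simp [Fintype.card_subtype_compl, hcard]) (by
      rintro ⟨x, hx⟩
      rw [← hfib x hx, ← Finset.card_map (Function.Embedding.subtype _)]
      congr 1
      ext y
      simp only [Finset.mem_map, Finset.mem_filter, Finset.mem_univ, true_and,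
        Function.Embedding.subtype_apply, Subtype.exists]
      grind)
  refine ⟨RelIso.symm ⟨(Equiv.optionCongr e.symm).trans (Equiv.optionSubtypeNe w₀), ?_⟩⟩
  rintro (_ | p) (_ | q) <;>
    simp only [Equiv.trans_apply, Equiv.optionCongr_apply, Option.map_none, Option.map_some,
      Equiv.optionSubtypeNe_some, Equiv.optionSubtypeNe_none]
  · simp
  · simp only [h₀, friendshipGraph_compl_not_adj_none]
  · rw [G.adj_comm, (friendshipGraph n)ᶜ.adj_comm]
    simp only [h₀, friendshipGraph_compl_not_adj_none]
  · have := he (e.symm p) (e.symm q)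
    simp only [Equiv.apply_symm_apply] at this
    rw [friendshipGraph_compl_adj_some, hadj _ _ (e.symm p).2 (e.symm q).2, ne_eq, ne_eq, ← this]

variable {G}

theorem neighborFinset_eq_of_not_adj
    (h : ∀ x y, ((G.neighborFinset x ∩ G.neighborFinset y).card + if G.Adj x y then 2 else 0) ^ 2
      = G.degree x * G.degree y)
    {x y : W} (hx : 0 < G.degree x) (hy : 0 < G.degree y) (hxy : ¬ G.Adj x y) :
    G.neighborFinset x = G.neighborFinset y := by
  have h1 := h x y
  rw [if_neg hxy, add_zero] at h1
  have h2 := Finset.card_le_card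
    (Finset.inter_subset_left (s₁ := G.neighborFinset x) (s₂ := G.neighborFinset y))
  have h3 := Finset.card_le_card
    (Finset.inter_subset_right (s₁ := G.neighborFinset x) (s₂ := G.neighborFinset y))
  rw [← card_neighborFinset_eq_degree] at hx hy h1
  rw [← card_neighborFinset_eq_degree] at h1
  have h4 := Finset.eq_of_subset_of_card_le
    (Finset.inter_subset_left (s₁ := G.neighborFinset x) (s₂ := G.neighborFinset y)) (by nlinarith)
  have h5 := Finset.eq_of_subset_of_card_le
    (Finset.inter_subset_right (s₁ := G.neighborFinset x) (s₂ := G.neighborFinset y)) (by nlinarith)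
  exact h4.symm.trans h5

theorem nonempty_iso_compl_friendshipGraph_of_sq_eq {n : ℕ} (hn : 3 ≤ n)
    (hcard : Fintype.card W = 2 * n + 1)
    (h : ∀ x y, ((G.neighborFinset x ∩ G.neighborFinset y).card + if G.Adj x y then 2 else 0) ^ 2
      = G.degree x * G.degree y)
    (hsum : ∑ x, G.degree x = 4 * n * (n - 1)) :
    Nonempty (G ≃g (friendshipGraph n)ᶜ) := by
  obtain ⟨k, rfl⟩ : ∃ k, n = k + 3 := ⟨n - 3, by omega⟩
  simp only [show k + 3 - 1 = k + 2 by omega] at hsum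
  set S := Finset.univ.filter fun x => 0 < G.degree x with hS
  have memS : ∀ x, x ∈ S ↔ 0 < G.degree x := by simp [hS]
  have adjS : ∀ {x y}, G.Adj x y → x ∈ S := fun {x y} hxy =>
    (memS x).2 ((G.degree_pos_iff_exists_adj x).2 ⟨y, hxy⟩)
  have hNS : ∀ x, G.neighborFinset x ⊆ S := fun x y hy =>
    adjS (((G.mem_neighborFinset x y).1 hy).symm)
  have hadj : ∀ x ∈ S, ∀ y ∈ S, (G.Adj x y ↔ G.neighborFinset x ≠ G.neighborFinset y) := by
    intro x hx y hy
    refine ⟨fun hxy hN => ?_, fun hN => ?_⟩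
    · have : y ∈ G.neighborFinset x := by simpa using hxy
      rw [hN] at this
      simp at this
    · by_contra hxy
      exact hN (neighborFinset_eq_of_not_adj h ((memS x).1 hx) ((memS y).1 hy) hxy)
  have hlt : ∀ x ∈ S, G.degree x < S.card := by
    intro x hx
    rw [← card_neighborFinset_eq_degree]
    exact Finset.card_lt_card ((Finset.ssubset_iff_of_subset (hNS x)).2 ⟨x, hx, by simp⟩)
  have hsumS : ∑ x ∈ S, G.degree x = 4 * (k + 3) * (k + 2) := by
    rw [← hsum]
    refine Finset.sum_subset (Finset.subset_univ _) fun x _ hx => ?_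
    rw [memS] at hx
    omega
  have hunion : ∀ x y, G.Adj x y → G.neighborFinset x ∪ G.neighborFinset y = S := by
    intro x y hxy
    refine (Finset.union_subset (hNS x) (hNS y)).antisymm fun z hz => ?_
    by_contra hcon
    simp only [Finset.mem_union, mem_neighborFinset, not_or] at hcon
    have h1 := hadj x (adjS hxy) z hz
    have h2 := hadj y (adjS hxy.symm) z hz
    have h3 := hadj x (adjS hxy) y (adjS hxy.symm)
    simp_all
  have hdeg : ∀ x ∈ S, G.degree x + 2 = S.card := by
    intro x hx
    obtain ⟨y, hxy⟩ := (G.degree_pos_iff_exists_adj x).1 ((memS x).1 hx)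
    have hy := adjS hxy.symm
    have h1 := Finset.card_union_add_card_inter (G.neighborFinset x) (G.neighborFinset y)
    rw [hunion x y hxy, card_neighborFinset_eq_degree, card_neighborFinset_eq_degree] at h1
    have h2 := h x y
    rw [if_pos hxy] at h2
    have h3 := hlt x hx
    have h4 := hlt y hy
    rw [memS] at hx hy
    rcases multipartite_arith (G.degree x) (G.degree y)
      (G.neighborFinset x ∩ G.neighborFinset y).card S.card (by omega) (by omega) (by omega)
      (by omega) (by omega) (by omega) (by exact_mod_cast h2) with h5 | h5
    · exfalso
      have h6 := Finset.sum_le_card_nsmul S (fun x => G.degree x) 4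
        fun z hz => by have := hlt z hz; omega
      rw [hsumS, smul_eq_mul] at h6
      nlinarith
    · omega
  have hScard : S.card = 2 * (k + 3) := by
    have h1 : ∑ x ∈ S, (G.degree x + 2) = S.card * S.card := by
      rw [Finset.sum_congr rfl hdeg]; simp
    rw [Finset.sum_add_distrib, hsumS, Finset.sum_const, smul_eq_mul] at h1
    nlinarith
  obtain ⟨w₀, hw₀⟩ : ∃ w₀, Sᶜ = {w₀} := by
    rw [← Finset.card_eq_one, Finset.card_compl, hcard, hScard]
    omega
  have hne : ∀ x, x ≠ w₀ ↔ x ∈ S := by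
    intro x
    rw [ne_eq, ← Finset.mem_singleton, ← hw₀, Finset.mem_compl, not_not]
  refine nonempty_iso_compl_friendshipGraph G w₀ (fun y hy => (hne w₀).2 (adjS hy) rfl) hcard
    (fun x y hx hy => hadj x ((hne x).1 hx) y ((hne y).1 hy)) fun x hx => ?_
  rw [hne] at hx
  have : (Finset.univ.filter fun y => y ≠ w₀ ∧ G.neighborFinset y = G.neighborFinset x)
      = S \ G.neighborFinset x := by
    ext y
    simp only [Finset.mem_filter, Finset.mem_univ, true_and, hne, Finset.mem_sdiff,
      mem_neighborFinset]
    refine and_congr_right fun hy => ?_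
    rw [hadj x hx y hy, not_not, eq_comm]
  rw [this, Finset.card_sdiff_of_subset (hNS x), card_neighborFinset_eq_degree, ← hdeg x hx]
  omega

end SimpleGraph

namespace Matrix.IsHermitian

variable {V : Type*} [Fintype V] [DecidableEq V] {A : Matrix V V ℝ}

theorem mul_self_add_two_smul_apply (hA : A.IsHermitian) (i j : V) :
    (A * A + (2 : ℝ) • A) i j = ∑ k, (hA.eigenvalues k ^ 2 + 2 * hA.eigenvalues k) *
      (hA.eigenvectorUnitary.1 i k * hA.eigenvectorUnitary.1 j k) := by
  set U : Matrix V V ℝ := hA.eigenvectorUnitary.1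
  have h1 : A = U * diagonal hA.eigenvalues * star U := by
    have := hA.spectral_theorem
    rwa [Unitary.conjStarAlgAut_apply] at this
  have h2 : star U * U = 1 := Unitary.coe_star_mul_self hA.eigenvectorUnitary
  have h3 : A * A + (2 : ℝ) • A
      = U * diagonal (fun k => hA.eigenvalues k ^ 2 + 2 * hA.eigenvalues k) * star U := by
    have h4 : diagonal (fun k => hA.eigenvalues k ^ 2 + 2 * hA.eigenvalues k)
        = diagonal hA.eigenvalues * diagonal hA.eigenvalues
          + (2 : ℝ) • diagonal hA.eigenvalues := by
      rw [diagonal_mul_diagonal, ← diagonal_smul, diagonal_add]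
      congr 1
      ext k
      simp [sq]
    rw [h4, mul_add, add_mul, Matrix.mul_smul, Matrix.smul_mul, ← h1]
    congr 1
    calc A * A = U * diagonal hA.eigenvalues * star U * (U * diagonal hA.eigenvalues * star U) := by
          rw [← h1]
      _ = U * diagonal hA.eigenvalues * (star U * U) * diagonal hA.eigenvalues * star U := by
          simp only [Matrix.mul_assoc]
      _ = _ := by rw [h2]; simp only [Matrix.mul_assoc, Matrix.one_mul]
  rw [h3, mul_apply]
  refine Finset.sum_congr rfl fun k _ => ?_
  rw [mul_diagonal, star_apply, star_trivial]
  ring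

theorem sum_eigenvectorUnitary_sq (hA : A.IsHermitian) (k : V) :
    ∑ i, hA.eigenvectorUnitary.1 i k * hA.eigenvectorUnitary.1 i k = 1 := by
  have h := congrFun (congrFun (Unitary.coe_star_mul_self hA.eigenvectorUnitary) k) k
  simpa [mul_apply, star_apply] using h

theorem sum_mul_self_add_two_smul_apply_self (hA : A.IsHermitian) :
    ∑ i, (A * A + (2 : ℝ) • A) i i
      = ∑ k, (hA.eigenvalues k ^ 2 + 2 * hA.eigenvalues k) := by
  simp_rw [hA.mul_self_add_two_smul_apply]
  rw [Finset.sum_comm]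
  simp_rw [← Finset.mul_sum, hA.sum_eigenvectorUnitary_sq, mul_one]

theorem roots_charpoly_eq_map_eigenvalues (hA : A.IsHermitian) :
    A.charpoly.roots = Finset.univ.val.map hA.eigenvalues :=
  hA.roots_charpoly_eq_eigenvalues

theorem sq_mul_self_add_two_smul_apply_of_roots (hA : A.IsHermitian) {a b : ℕ} {c : ℝ}
    (h : A.charpoly.roots = Multiset.replicate a (-2) + Multiset.replicate b 0 + {c}) (i j : V) :
    (A * A + (2 : ℝ) • A) i j ^ 2
      = (A * A + (2 : ℝ) • A) i i * (A * A + (2 : ℝ) • A) j j := by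
  rw [hA.roots_charpoly_eq_map_eigenvalues] at h
  obtain ⟨k, -, hk⟩ : ∃ k ∈ Finset.univ.val, hA.eigenvalues k = c := by
    rw [← Multiset.mem_map, h]
    simp
  have h' : (Finset.univ.erase k).val.map hA.eigenvalues
      = Multiset.replicate a (-2) + Multiset.replicate b 0 := by
    rw [← Finset.insert_erase (Finset.mem_univ k), Finset.insert_val_of_notMem (by simp),
      Multiset.map_cons, hk, add_comm _ ({c} : Multiset ℝ), Multiset.singleton_add, Multiset.cons_inj_right] at h
    exact h
  have hz : ∀ l, l ≠ k → hA.eigenvalues l ^ 2 + 2 * hA.eigenvalues l = 0 := by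
    intro l hl
    have : hA.eigenvalues l ∈ (Finset.univ.erase k).val.map hA.eigenvalues :=
      Multiset.mem_map_of_mem _ (Finset.mem_erase.2 ⟨hl, Finset.mem_univ l⟩)
    rw [h', Multiset.mem_add] at this
    rcases this with h1 | h1 <;> rw [Multiset.eq_of_mem_replicate h1] <;> norm_num
  have key : ∀ i j, (A * A + (2 : ℝ) • A) i j = (c ^ 2 + 2 * c) *
      (hA.eigenvectorUnitary.1 i k * hA.eigenvectorUnitary.1 j k) := by
    intro i j
    rw [hA.mul_self_add_two_smul_apply, Finset.sum_eq_single k, hk]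
    · intro l _ hl
      rw [hz l hl, zero_mul]
    · simp
  rw [key, key, key]
  ring

theorem eigenvalues_mem_of_mul_eq (hA : A.IsHermitian) {c : ℝ}
    (h : (A * A + (2 : ℝ) • A) * A = c • (A * A + (2 : ℝ) • A)) (k : V) :
    hA.eigenvalues k = -2 ∨ hA.eigenvalues k = 0 ∨ hA.eigenvalues k = c := by
  set v : V → ℝ := ⇑(hA.eigenvectorBasis k)
  set l := hA.eigenvalues k
  have hAv : A *ᵥ v = l • v := hA.mulVec_eigenvectorBasis k
  have hv0 : v ≠ 0 := fun h0 =>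
    hA.eigenvectorBasis.orthonormal.ne_zero k (PiLp.ext fun i => congrFun h0 i)
  have h1 := congrArg (· *ᵥ v) h
  simp only [← mulVec_mulVec, add_mulVec, smul_mulVec, hAv, mulVec_smul, smul_smul, ← add_smul,
    smul_add] at h1
  have h2 := smul_left_injective ℝ hv0 h1
  have h3 : (l + 2) * (l * (l - c)) = 0 := by linear_combination h2
  rcases mul_eq_zero.1 h3 with h4 | h4
  · left; linarith
  rcases mul_eq_zero.1 h4 with h5 | h5
  · exact Or.inr (Or.inl h5)
  · right; right; linarith

end Matrix.IsHermitian

theorem Multiset.exists_eq_replicate_add_of_forall_mem {α : Type*} {x y z : α} (s : Multiset α)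
    (h : ∀ w ∈ s, w = x ∨ w = y ∨ w = z) :
    ∃ a b c, s = replicate a x + replicate b y + replicate c z := by
  induction s using Multiset.induction with
  | empty => exact ⟨0, 0, 0, by simp⟩
  | cons w s ih =>
    obtain ⟨a, b, c, rfl⟩ := ih fun w hw => h w (mem_cons_of_mem hw)
    rcases h w (mem_cons_self _ _) with rfl | rfl | rfl
    · exact ⟨a + 1, b, c, by simp [replicate_succ]⟩
    · exact ⟨a, b + 1, c, by simp [replicate_succ]⟩
    · exact ⟨a, b, c + 1, by simp [replicate_succ]⟩

namespace SimpleGraph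

theorem isHermitian_adjMatrix_real {V : Type*} [Fintype V] (G : SimpleGraph V)
    [DecidableRel G.Adj] : (G.adjMatrix ℝ).IsHermitian := by
  rw [Matrix.IsHermitian, Matrix.conjTranspose_eq_transpose_of_trivial, transpose_adjMatrix]

theorem adjMatrix_mul_self_add_two_smul_apply {V : Type*} [Fintype V] [DecidableEq V]
    (G : SimpleGraph V) [DecidableRel G.Adj] (x y : V) :
    (G.adjMatrix ℝ * G.adjMatrix ℝ + (2 : ℝ) • G.adjMatrix ℝ) x y
      = (((G.neighborFinset x ∩ G.neighborFinset y).card + if G.Adj x y then 2 else 0 : ℕ) : ℝ) := by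
  have : G.neighborFinset x ∩ G.neighborFinset y
      = (G.neighborFinset x).filter fun u => G.Adj u y := by
    ext u
    simp [G.adj_comm u y]
  rw [this, Matrix.add_apply, adjMatrix_mul_apply, Matrix.smul_apply]
  simp [adjMatrix_apply]

theorem adjMatrix_compl_friendshipGraph_some (n : ℕ) [DecidableRel (friendshipGraph n)ᶜ.Adj]
    (p q : Fin n × Bool) :
    (friendshipGraph n)ᶜ.adjMatrix ℝ (some p) (some q) = if p.1 = q.1 then 0 else 1 := by
  rw [adjMatrix_apply]
  simp only [friendshipGraph_compl_adj_some]
  split_ifs <;> simp_all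

theorem adjMatrix_compl_friendshipGraph_none (n : ℕ) [DecidableRel (friendshipGraph n)ᶜ.Adj] (v) :
    (friendshipGraph n)ᶜ.adjMatrix ℝ none v = 0 := by
  rw [adjMatrix_apply, if_neg (friendshipGraph_compl_not_adj_none n v)]

theorem adjMatrix_compl_friendshipGraph_none_right (n : ℕ)
    [DecidableRel (friendshipGraph n)ᶜ.Adj] (v) :
    (friendshipGraph n)ᶜ.adjMatrix ℝ v none = 0 := by
  rw [adjMatrix_apply, if_neg fun h => friendshipGraph_compl_not_adj_none n v h.symm]

theorem mul_self_add_two_smul_adjMatrix_compl_friendshipGraph (n : ℕ)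
    [DecidableRel (friendshipGraph n)ᶜ.Adj] :
    (friendshipGraph n)ᶜ.adjMatrix ℝ * (friendshipGraph n)ᶜ.adjMatrix ℝ
        + (2 : ℝ) • (friendshipGraph n)ᶜ.adjMatrix ℝ
      = Matrix.of fun u v => if u = none ∨ v = none then 0 else 2 * (n : ℝ) - 2 := by
  ext (_ | ⟨i, b⟩) (_ | ⟨j, c⟩)
  all_goals simp only [Matrix.add_apply, Matrix.smul_apply, Matrix.mul_apply, Fintype.sum_option,
    adjMatrix_compl_friendshipGraph_none, adjMatrix_compl_friendshipGraph_none_right,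
    adjMatrix_compl_friendshipGraph_some, Matrix.of_apply]
  · simp
  · simp
  · simp
  · have h : ∀ k : Fin n, (if i = k then (0 : ℝ) else 1) * (if k = j then 0 else 1)
        = 1 - (if i = k then 1 else 0) - (if k = j then 1 else 0)
          + if i = k then (if i = j then 1 else 0) else 0 := by
      intro k
      by_cases h1 : i = k
      · subst h1
        split_ifs <;> norm_num
      · split_ifs <;> norm_num
    simp only [Fintype.sum_prod_type, Fintype.sum_bool, h, Finset.sum_add_distrib,
      Finset.sum_sub_distrib]
    simp
    split_ifs <;> ring

theorem mul_adjMatrix_compl_friendshipGraph (n : ℕ) [DecidableRel (friendshipGraph n)ᶜ.Adj] :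
    (Matrix.of fun u v => if u = none ∨ v = none then 0 else 2 * (n : ℝ) - 2)
        * (friendshipGraph n)ᶜ.adjMatrix ℝ
      = (2 * (n : ℝ) - 2) •
        Matrix.of fun u v => if u = none ∨ v = none then 0 else 2 * (n : ℝ) - 2 := by
  ext (_ | ⟨i, b⟩) (_ | ⟨j, c⟩)
  all_goals simp only [Matrix.smul_apply, Matrix.mul_apply, Fintype.sum_option,
    adjMatrix_compl_friendshipGraph_none, adjMatrix_compl_friendshipGraph_none_right,
    adjMatrix_compl_friendshipGraph_some, Matrix.of_apply]
  · simp
  · simp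
  · simp
  · have h : ∀ k : Fin n, (if k = j then (0 : ℝ) else 1) = 1 - if k = j then 1 else 0 := by
      intro k
      split_ifs <;> norm_num
    simp only [Fintype.sum_prod_type, Fintype.sum_bool, h, mul_sub, Finset.sum_add_distrib,
      Finset.sum_sub_distrib]
    simp
    ring

theorem roots_charpoly_adjMatrix_compl_friendshipGraph {n : ℕ} (hn : 3 ≤ n)
    [DecidableRel (friendshipGraph n)ᶜ.Adj] :
    ((friendshipGraph n)ᶜ.adjMatrix ℝ).charpoly.roots
      = Multiset.replicate (n - 1) (-2) + Multiset.replicate (n + 1) 0 + {2 * (n : ℝ) - 2} := by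
  have hA := (friendshipGraph n)ᶜ.isHermitian_adjMatrix_real
  have hM := mul_self_add_two_smul_adjMatrix_compl_friendshipGraph n
  obtain ⟨k, rfl⟩ : ∃ k, n = k + 3 := ⟨n - 3, by omega⟩
  have htr := hA.trace_eq_sum_eigenvalues
  have hsq := hA.sum_mul_self_add_two_smul_apply_self
  rw [trace_adjMatrix] at htr
  rw [hM] at hsq
  obtain ⟨a, b, c, h⟩ := Multiset.exists_eq_replicate_add_of_forall_mem
    (x := -2) (y := 0) (z := 2 * ((k + 3 : ℕ) : ℝ) - 2) (Finset.univ.val.map hA.eigenvalues) (by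
      intro w hw
      obtain ⟨l, -, rfl⟩ := Multiset.mem_map.1 hw
      exact hA.eigenvalues_mem_of_mul_eq
        (by rw [hM, mul_adjMatrix_compl_friendshipGraph]) l)
  have h1 := congrArg Multiset.card h
  have h2 := congrArg Multiset.sum h
  have h3 := congrArg (fun s => (s.map fun x => x ^ 2 + 2 * x).sum) h
  simp only [Multiset.map_map, Multiset.map_add, Multiset.sum_add, Multiset.map_replicate,
    Multiset.sum_replicate, Function.comp_def] at h3
  change ∑ l, (hA.eigenvalues l ^ 2 + 2 * hA.eigenvalues l) = _ at h3
  change ∑ l, hA.eigenvalues l = _ at h2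
  rw [← hsq] at h3
  simp only [RCLike.ofReal_real_eq_id, id] at htr
  rw [← htr] at h2
  simp [Fintype.sum_option] at h1 h2 h3
  have hk : (0 : ℝ) ≤ k := k.cast_nonneg
  have hc : (c : ℝ) = 1 := by
    have : ((k : ℝ) + 3) * (k + 2) * (c - 1) = 0 := by linear_combination -h3 / 4
    have h0 : ((k : ℝ) + 3) * (k + 2) ≠ 0 := by positivity
    linarith [(mul_eq_zero.1 this).resolve_left h0]
  rw [hc] at h2
  have ha : (a : ℝ) = (k + 2 : ℕ) := by push_cast; linarith
  have hc' : c = 1 := by exact_mod_cast hc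
  have ha' : a = k + 2 := by exact_mod_cast ha
  rw [hA.roots_charpoly_eq_map_eigenvalues, h, hc', ha', show b = k + 3 + 1 by omega]
  simp

end SimpleGraph

/-- for `n ≥ 3`, the complement of the friendship graph `F n` has adjacency
spectrum `{(−2)^{n−1}, 0^{n+1}, (2n−2)¹}`, and it is determined by its adjacency spectrum:
every graph cospectral with `(F n)ᶜ` is isomorphic to `(F n)ᶜ`. -/
theorem complement_friendship_DS (n : ℕ) (hn : 3 ≤ n) :
    ((adjMat ℝ (friendshipGraph n)ᶜ).charpoly.roots
      = Multiset.replicate (n - 1) (-2) + Multiset.replicate (n + 1) 0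
        + {2 * (n : ℝ) - 2}) ∧
    ∀ (W : Type) [Fintype W] [DecidableEq W] (H : SimpleGraph W),
      Cospectral H (friendshipGraph n)ᶜ → Nonempty (H ≃g (friendshipGraph n)ᶜ) := by
  classical
  let _ := Classical.decRel (friendshipGraph n)ᶜ.Adj
  have hroots : (adjMat ℝ (friendshipGraph n)ᶜ).charpoly.roots
      = Multiset.replicate (n - 1) (-2) + Multiset.replicate (n + 1) 0 + {2 * (n : ℝ) - 2} :=
    SimpleGraph.roots_charpoly_adjMatrix_compl_friendshipGraph hn
  refine ⟨hroots, fun W _ _ H hH => ?_⟩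
  let _ := Classical.decRel H.Adj
  rw [← show (adjMat ℝ H).charpoly = _ from hH] at hroots
  change (H.adjMatrix ℝ).charpoly.roots = _ at hroots
  have hA := H.isHermitian_adjMatrix_real
  have heig := hroots
  rw [hA.roots_charpoly_eq_map_eigenvalues] at heig
  have hcard := congrArg Multiset.card heig
  have hsum := congrArg (fun s => (s.map fun x => x ^ 2 + 2 * x).sum) heig
  simp only [Multiset.map_map, Multiset.map_add, Multiset.sum_add, Multiset.map_replicate,
    Multiset.sum_replicate, Function.comp_def, Multiset.map_singleton,
    Multiset.sum_singleton] at hsum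
  change ∑ l, (hA.eigenvalues l ^ 2 + 2 * hA.eigenvalues l) = _ at hsum
  rw [← hA.sum_mul_self_add_two_smul_apply_self] at hsum
  have hdiag : ∀ x, (H.adjMatrix ℝ * H.adjMatrix ℝ + (2 : ℝ) • H.adjMatrix ℝ) x x
      = (H.degree x : ℝ) := by
    intro x
    rw [H.adjMatrix_mul_self_add_two_smul_apply]
    simp
  refine SimpleGraph.nonempty_iso_compl_friendshipGraph_of_sq_eq hn ?_ (fun x y => ?_) ?_
  · simp at hcard
    omega
  · have := hA.sq_mul_self_add_two_smul_apply_of_roots hroots x y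
    rw [hdiag, hdiag, H.adjMatrix_mul_self_add_two_smul_apply] at this
    exact_mod_cast this
  · simp only [hdiag] at hsum
    rify [show 1 ≤ n by omega]
    rw [hsum]
    simp
    ring
end
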